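/- Let A be a densely defined normal operator on a complex Hilbert space H and let B be an everywhere-defined bounded self-adjoint operator on H. Assume BA* ⊂ −AB, i.e., for every x ∈ D(A*) one has Bx ∈ D(A) and BA*x = −ABx. Then A+B, with domain D(A), is normal: (A+B)*(A+B) = (A+B)(A+B)*. -/

import Mathlib

open LinearPMap
open scoped InnerProductSpace

variable {H : Type*} [NormedAddCommGroup H] [InnerProductSpace ℂ H] [CompleteSpace H]

/-- The product `S * T` of unbounded operators, with domain
`{x ∈ D(T) : T x ∈ D(S)}` and value `x ↦ S (T x)`. -/
noncomputable def LinearPMap.pmul (S T : H →ₗ.[ℂ] H) : H →ₗ.[ℂ] H :=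
  S.comp (T.domRestrict ((Submodule.comap T.toFun S.domain).map T.domain.subtype))
    (fun x => by
      obtain ⟨y, hy, hyx⟩ := x.2.1
      have h : T.domRestrict _ x = T y := LinearPMap.domRestrict_apply hyx.symm
      rw [h]; exact hy)

/-- A densely defined closed operator `S` is normal if `S* S = S S*`
(as operators, with equal domains). -/
structure LinearPMap.IsNormalOp (S : H →ₗ.[ℂ] H) : Prop where
  dense : Dense (S.domain : Set H)
  isClosed : S.IsClosed
  adjoint_mul_comm : S†.pmul S = S.pmul S†

namespace LinearPMap

theorem mem_graph_pmul_iff (S T : H →ₗ.[ℂ] H) (x z : H) :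
    (x, z) ∈ (S.pmul T).graph ↔ ∃ y, (x, y) ∈ T.graph ∧ (y, z) ∈ S.graph := by
  have key : ∀ u : (S.pmul T).domain, ∃ y, ((u : H), y) ∈ T.graph ∧ (y, S.pmul T u) ∈ S.graph := by
    intro u
    obtain ⟨v, hv, hvu⟩ := u.2.1
    have hu : T.domRestrict ((Submodule.comap T.toFun S.domain).map T.domain.subtype) u = T v :=
      LinearPMap.domRestrict_apply hvu.symm
    refine ⟨T v, ?_, ?_⟩
    · rw [← hvu]
      exact T.mem_graph v
    · rw [← hu]
      exact S.mem_graph ⟨_, _⟩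
  constructor
  · intro h
    obtain ⟨u, hu, hz⟩ := (mem_graph_iff _).1 h
    simp only at hu hz
    rw [← hu, ← hz]
    exact key u
  · rintro ⟨y, hxy, hyz⟩
    obtain ⟨v, hv, hvy⟩ := (mem_graph_iff _).1 hxy
    simp only at hv hvy
    have hx : x ∈ (S.pmul T).domain := by
      refine ⟨⟨v, ?_, hv⟩, hv ▸ v.2⟩
      change T v ∈ S.domain
      rw [hvy]
      exact mem_domain_of_mem_graph hyz
    obtain ⟨y', hxy', hy'z'⟩ := key ⟨x, hx⟩
    have hy : y' = y := T.mem_graph_snd_inj hxy' hxy rfl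
    have hz : S.pmul T ⟨x, hx⟩ = z := S.mem_graph_snd_inj hy'z' hyz hy
    rw [← hz]
    exact mem_graph _ ⟨x, hx⟩

theorem mem_graph_adjoint_iff {A : H →ₗ.[ℂ] H} (hA : Dense (A.domain : Set H)) (y w : H) :
    (y, w) ∈ A†.graph ↔ ∀ a a', (a, a') ∈ A.graph → ⟪a', y⟫_ℂ = ⟪a, w⟫_ℂ := by
  rw [adjoint_graph_eq_graph_adjoint hA, Submodule.mem_adjoint_iff]
  simp only [sub_eq_zero]

theorem mem_graph_add_toPMap_iff (A : H →ₗ.[ℂ] H) (B : H →L[ℂ] H) (x z : H) :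
    (x, z) ∈ (A + (B : H →ₗ[ℂ] H).toPMap ⊤).graph ↔ (x, z - B x) ∈ A.graph := by
  simp only [mem_graph_iff]
  constructor
  · rintro ⟨v, hv, hz⟩
    refine ⟨⟨v, v.2.1⟩, hv, ?_⟩
    rw [← hz, ← hv]
    exact (add_sub_cancel_right _ _).symm
  · rintro ⟨v, hv, hz⟩
    refine ⟨⟨v, v.2, trivial⟩, hv, ?_⟩
    rw [eq_sub_iff_add_eq] at hz
    rw [← hz, ← hv]
    rfl

theorem mem_graph_adjoint_add_toPMap_iff {A : H →ₗ.[ℂ] H} (hA : Dense (A.domain : Set H))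
    {B : H →L[ℂ] H} (hB : ∀ x y : H, ⟪B x, y⟫_ℂ = ⟪x, B y⟫_ℂ) (x z : H) :
    (x, z) ∈ (A + (B : H →ₗ[ℂ] H).toPMap ⊤)†.graph ↔ (x, z - B x) ∈ A†.graph := by
  have hd : Dense ((A + (B : H →ₗ[ℂ] H).toPMap ⊤).domain : Set H) := by
    have : (A + (B : H →ₗ[ℂ] H).toPMap ⊤).domain = A.domain := inf_top_eq _
    rwa [this]
  rw [mem_graph_adjoint_iff hd, mem_graph_adjoint_iff hA]
  simp only [mem_graph_add_toPMap_iff]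
  constructor
  · intro h a a' ha
    have := h a (a' + B a) (by simpa using ha)
    rw [inner_add_left, hB] at this
    rw [inner_sub_right, ← this, add_sub_cancel_right]
  · intro h a a' ha
    have := h a _ ha
    rw [inner_sub_left, inner_sub_right, hB] at this
    exact sub_left_injective this

/-- Von Neumann: for closed densely defined `A` there are bounded operators `R = (1 + A* A)⁻¹` and
`T = A R`. -/
theorem exists_resolvent {A : H →ₗ.[ℂ] H} (hd : Dense (A.domain : Set H)) (hc : A.IsClosed) :
    ∃ R T : H →L[ℂ] H, ∀ v, (R v, T v) ∈ A.graph ∧ (T v, v - R v) ∈ A†.graph := by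
  let e := WithLp.prodContinuousLinearEquiv 2 ℂ H H
  let G : Submodule ℂ (WithLp 2 (H × H)) := A.graph.comap e.toLinearEquiv.toLinearMap
  have hG : _root_.IsClosed (G : Set (WithLp 2 (H × H))) := hc.preimage e.continuous
  have : CompleteSpace G := hG.completeSpace_coe
  let P : H →L[ℂ] H × H := e.toContinuousLinearMap ∘L G.starProjection ∘L
    e.symm.toContinuousLinearMap ∘L ContinuousLinearMap.inl ℂ H H
  refine ⟨ContinuousLinearMap.fst ℂ H H ∘L P, ContinuousLinearMap.snd ℂ H H ∘L P,
    fun v => ⟨G.starProjection_apply_mem _, ?_⟩⟩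
  rw [mem_graph_adjoint_iff hd]
  intro a a' ha
  have h := G.sub_starProjection_mem_orthogonal (e.symm (v, 0)) (e.symm (a, a')) ha
  rw [WithLp.prod_inner_apply] at h
  change ⟪a, v - (P v).1⟫_ℂ + ⟪a', 0 - (P v).2⟫_ℂ = 0 at h
  rw [zero_sub, inner_neg_right] at h
  change ⟪a', (P v).2⟫_ℂ = ⟪a, v - (P v).1⟫_ℂ
  linear_combination -h

end LinearPMap

theorem ContinuousLinearMap.exists_cutoff {R : H →L[ℂ] H} (hR : 0 ≤ R) {ε : ℝ} (hε : 0 < ε) :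
    ∃ F K : H →L[ℂ] H, IsSelfAdjoint F ∧ IsSelfAdjoint K ∧ ‖F‖ ≤ 1 ∧ ‖F * R - R‖ ≤ 2 * ε ∧
      R * (K * F) = F ∧ ∀ b, Commute R b → Commute F b ∧ Commute K b := by
  have hs : IsSelfAdjoint R := IsSelfAdjoint.of_nonneg hR
  let f : ℝ → ℝ := fun t => min 1 (max 0 (t / ε - 1))
  let k : ℝ → ℝ := fun t => (max t ε)⁻¹
  have hf : Continuous f := by fun_prop
  have hk : Continuous k := by
    refine Continuous.inv₀ (by fun_prop) fun t => ?_
    exact (lt_of_lt_of_le hε (le_max_right _ _)).ne'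
  have hf0 : ∀ t, 0 ≤ f t := fun t => le_min zero_le_one (le_max_left _ _)
  have hf1 : ∀ t, f t ≤ 1 := fun t => min_le_left _ _
  refine ⟨cfc f R, cfc k R, cfc_predicate f R, cfc_predicate k R, ?_, ?_, ?_, ?_⟩
  · refine norm_cfc_le zero_le_one fun t _ => ?_
    rw [Real.norm_of_nonneg (hf0 t)]
    exact hf1 t
  · have : cfc f R * R - R = cfc (fun t => f t * t - t) R := by
      rw [cfc_sub (fun t => f t * t) (fun t => t) R (hf.mul continuous_id).continuousOn
        continuousOn_id, cfc_mul f (fun t => t) R hf.continuousOn continuousOn_id, cfc_id' ℝ R]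
    rw [this]
    refine norm_cfc_le (by positivity) fun t ht => ?_
    have ht0 : 0 ≤ t := spectrum_nonneg_of_nonneg hR ht
    rw [Real.norm_eq_abs, abs_le]
    have h0 := hf0 t
    have h1 := hf1 t
    constructor
    · by_cases h : t ≤ 2 * ε
      · nlinarith
      · have : f t = 1 := by
          have : 2 ≤ t / ε := by
            rw [le_div_iff₀ hε]
            linarith
          exact min_eq_left (le_max_of_le_right (by linarith))
        rw [this]
        linarith
    · nlinarith
  · have : R * (cfc k R * cfc f R) = cfc (fun t => t * (k t * f t)) R := by
      rw [cfc_mul (fun t => t) (fun t => k t * f t) R continuousOn_id (hk.mul hf).continuousOn,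
        cfc_mul k f R hk.continuousOn hf.continuousOn, cfc_id' ℝ R]
    rw [this]
    congr 1
    funext t
    by_cases h : t ≤ ε
    · have : f t = 0 := by
        have : t / ε ≤ 1 := by
          rw [div_le_one hε]
          exact h
        change min 1 (max 0 (t / ε - 1)) = 0
        rw [max_eq_left (by linarith), min_eq_right zero_le_one]
      simp [this]
    · have hm : k t = t⁻¹ := by
        change (max t ε)⁻¹ = _
        rw [max_eq_left (not_le.1 h).le]
      rw [hm, mul_inv_cancel_left₀ (hε.trans (not_le.1 h)).ne']
  · exact fun b hb => ⟨hb.cfc_real f, hb.cfc_real k⟩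

open Filter Topology in
theorem ContinuousLinearMap.tendsto_apply_of_norm_mul_sub_le {R : H →L[ℂ] H}
    (hR : DenseRange R) {F : ℕ → H →L[ℂ] H} {ε : ℕ → ℝ} (hε : Tendsto ε atTop (𝓝 0))
    (hF : ∀ n, ‖F n‖ ≤ 1) (hFR : ∀ n, ‖F n * R - R‖ ≤ ε n) (x : H) :
    Tendsto (fun n => F n x) atTop (𝓝 x) := by
  rw [Metric.tendsto_atTop]
  intro δ hδ
  obtain ⟨v, hv⟩ := hR.exists_dist_lt x (show 0 < δ / 3 by positivity)
  have ht : Tendsto (fun n => ε n * ‖v‖) atTop (𝓝 0) := by simpa using hε.mul_const ‖v‖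
  obtain ⟨N, hN⟩ := eventually_atTop.1 (ht.eventually (gt_mem_nhds (show 0 < δ / 3 by positivity)))
  refine ⟨N, fun n hn => ?_⟩
  rw [dist_eq_norm] at hv ⊢
  have h1 : ‖F n (x - R v)‖ ≤ ‖x - R v‖ := by
    simpa using (F n).le_of_opNorm_le (hF n) (x - R v)
  have h2 : ‖F n (R v) - R v‖ ≤ ε n * ‖v‖ := (F n * R - R).le_of_opNorm_le (hFR n) v
  have h3 : F n x - x = F n (x - R v) + (F n (R v) - R v) - (x - R v) := by
    rw [_root_.map_sub]
    abel
  have h4 := norm_sub_le (F n (x - R v) + (F n (R v) - R v)) (x - R v)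
  have h5 := norm_add_le (F n (x - R v)) (F n (R v) - R v)
  have h6 := hN n hn
  rw [h3]
  linarith

namespace LinearPMap.IsNormalOp

variable {A : H →ₗ.[ℂ] H}

theorem exists_adjoint_self_iff (hA : A.IsNormalOp) (x z : H) :
    (∃ y, (x, y) ∈ A.graph ∧ (y, z) ∈ A†.graph) ↔
      ∃ y, (x, y) ∈ A†.graph ∧ (y, z) ∈ A.graph := by
  rw [← mem_graph_pmul_iff, ← mem_graph_pmul_iff, hA.adjoint_mul_comm]

/-- The resolvent `R = (1 + A* A)⁻¹` of a normal operator `A` together with the bounded normal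
operator `T = A R`. -/
theorem exists_normal_resolvent (hA : A.IsNormalOp) :
    ∃ R T : H →L[ℂ] H, 0 ≤ R ∧ DenseRange R ∧ IsStarNormal T ∧ Commute R T ∧
      (∀ x y, (x, y) ∈ A.graph → T x = R y) ∧ (∀ v, (R v, star T v) ∈ A†.graph) := by
  obtain ⟨R, T, hRT⟩ := exists_resolvent hA.dense hA.isClosed
  have hadj : ∀ {a a' y w}, (a, a') ∈ A.graph → (y, w) ∈ A†.graph → ⟪a', y⟫_ℂ = ⟪a, w⟫_ℂ :=
    fun ha hy => (mem_graph_adjoint_iff hA.dense _ _).1 hy _ _ ha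
  have hadj' : ∀ {a a' y w}, (a, a') ∈ A.graph → (y, w) ∈ A†.graph → ⟪y, a'⟫_ℂ = ⟪w, a⟫_ℂ :=
    fun ha hy => by rw [← inner_conj_symm, hadj ha hy, inner_conj_symm]
  have huniq : ∀ {x y z}, (x, y) ∈ A.graph → (y, z) ∈ A†.graph → R (x + z) = x ∧ T (x + z) = y := by
    intro x y z hxy hyz
    have h1 := A.graph.sub_mem hxy (hRT (x + z)).1
    have h2 := A†.graph.sub_mem hyz (hRT (x + z)).2
    have h3 := hadj h1 h2
    have h4 : z - (x + z - R (x + z)) = -(x - R (x + z)) := by abel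
    change ⟪y - T (x + z), y - T (x + z)⟫_ℂ = ⟪x - R (x + z), z - (x + z - R (x + z))⟫_ℂ at h3
    rw [h4, inner_neg_right] at h3
    rw [inner_self_eq_norm_sq_to_K, inner_self_eq_norm_sq_to_K] at h3
    have h5 : ‖y - T (x + z)‖ ^ 2 = -‖x - R (x + z)‖ ^ 2 := by exact_mod_cast h3
    have h6 : ‖y - T (x + z)‖ = 0 := by nlinarith [sq_nonneg ‖x - R (x + z)‖]
    have h7 : ‖x - R (x + z)‖ = 0 := by nlinarith [sq_nonneg ‖y - T (x + z)‖]
    exact ⟨(sub_eq_zero.1 (norm_eq_zero.1 h7)).symm, (sub_eq_zero.1 (norm_eq_zero.1 h6)).symm⟩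
  have hinner : ∀ u v, ⟪R u, v⟫_ℂ = ⟪R u, R v⟫_ℂ + ⟪T u, T v⟫_ℂ := by
    intro u v
    rw [hadj (hRT u).1 (hRT v).2, ← inner_add_right, add_sub_cancel]
  have hsymm : ∀ u v, ⟪R u, v⟫_ℂ = ⟪u, R v⟫_ℂ := by
    intro u v
    rw [hinner, ← inner_conj_symm u, hinner v u, _root_.map_add, inner_conj_symm, inner_conj_symm]
  have hre : ∀ v, RCLike.re ⟪R v, v⟫_ℂ = ‖R v‖ ^ 2 + ‖T v‖ ^ 2 := by
    intro v
    rw [hinner, _root_.map_add, inner_self_eq_norm_sq, inner_self_eq_norm_sq]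
  have hTA : ∀ x y, (x, y) ∈ A.graph → T x = R y := by
    intro x y hxy
    obtain ⟨w, hw, hw'⟩ := (hA.exists_adjoint_self_iff _ _).2
      ⟨_, (hRT x).2, A.graph.sub_mem hxy (hRT x).1⟩
    simpa using (huniq hw hw').1.symm
  have hTadj : ∀ v, (R v, star T v) ∈ A†.graph ∧ (star T v, v - R v) ∈ A.graph := by
    intro v
    obtain ⟨w, hw, hw'⟩ := (hA.exists_adjoint_self_iff _ _).1 ⟨_, (hRT v).1, (hRT v).2⟩
    have h : star T v = w := by
      refine ext_inner_left ℂ fun k => ?_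
      rw [ContinuousLinearMap.star_eq_adjoint, ContinuousLinearMap.adjoint_inner_right]
      have h1 := hadj (hRT k).1 hw
      have h2 := hadj' hw' (hRT k).2
      rw [inner_sub_left, inner_sub_right] at h2
      linear_combination h1 + h2
    rw [h]
    exact ⟨hw, hw'⟩
  refine ⟨R, T, ?_, ?_, ⟨?_⟩, ?_, hTA, fun v => (hTadj v).1⟩
  · rw [ContinuousLinearMap.nonneg_iff_isPositive, ContinuousLinearMap.isPositive_def]
    refine ⟨hsymm, fun v => ?_⟩
    rw [ContinuousLinearMap.reApplyInnerSelf_apply, hre]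
    positivity
  · change Dense (LinearMap.range (R : H →ₗ[ℂ] H) : Set H)
    rw [Submodule.dense_iff_topologicalClosure_eq_top, Submodule.topologicalClosure_eq_top_iff,
      Submodule.eq_bot_iff]
    intro v hv
    have h0 : ⟪R v, v⟫_ℂ = 0 := hv _ ⟨v, rfl⟩
    have h1 := hre v
    rw [h0, _root_.map_zero] at h1
    have h2 : R v = 0 := norm_eq_zero.1 (by nlinarith [sq_nonneg ‖R v‖, sq_nonneg ‖T v‖])
    have h3 : T v = 0 := norm_eq_zero.1 (by nlinarith [sq_nonneg ‖R v‖, sq_nonneg ‖T v‖])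
    have h4 := (hRT v).2
    rw [h2, h3, sub_zero] at h4
    exact A†.graph_fst_eq_zero_snd h4 rfl
  · ext v
    have h1 := hTA _ _ (hTadj v).2
    have h2 := (hTadj (T v)).1
    rw [← hTA _ _ (hRT v).1] at h2
    change star T (T v) = T (star T v)
    rw [h1, _root_.map_sub]
    exact A†.mem_graph_snd_inj h2 (hRT (R v)).2 rfl
  · ext v
    exact (hTA _ _ (hRT v).1).symm

/-- A Fuglede-Putnam theorem: if `B` is bounded and `B A* ⊂ -A B` then `B A ⊂ -A* B`. -/
theorem apply_mem_graph_adjoint (hA : A.IsNormalOp) {B : H →L[ℂ] H}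
    (hanti : ∀ x y, (x, y) ∈ A†.graph → (B x, -B y) ∈ A.graph) {x y : H}
    (hxy : (x, y) ∈ A.graph) : (B x, -B y) ∈ A†.graph := by
  obtain ⟨R, T, hR, hdense, hT, hcomm, hTA, hTadj⟩ := hA.exists_normal_resolvent
  have hε : ∀ n : ℕ, 0 < 1 / ((n : ℝ) + 1) := fun n => Nat.one_div_pos_of_nat
  choose F K hF hK hF1 hFR hRKF hC using
    fun n : ℕ => ContinuousLinearMap.exists_cutoff hR (hε n)
  have hlim := ContinuousLinearMap.tendsto_apply_of_norm_mul_sub_le hdense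
    (by simpa using (tendsto_one_div_add_atTop_nhds_zero_nat (𝕜 := ℝ)).const_mul 2) hF1 hFR
  rw [mem_graph_adjoint_iff hA.dense]
  intro a a' ha
  have hstar : ∀ {S : H →L[ℂ] H}, IsSelfAdjoint S → ∀ u v, ⟪S u, v⟫_ℂ = ⟪u, S v⟫_ℂ :=
    fun hS => hS.isSymmetric
  have key : ∀ n, ⟪F n a', B (F n x)⟫_ℂ = ⟪F n a, -B (F n y)⟫_ℂ := by
    intro n
    have hFT : Commute (F n) T := (hC n T hcomm).1
    have hKT : Commute (K n) T := (hC n T hcomm).2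
    have hFr : Commute (F n) R := (hC n R (Commute.refl R)).1
    have hKr : Commute (K n) R := (hC n R (Commute.refl R)).2
    have hKF : Commute (K n) (F n) := (hC n (F n) hFr.symm).2
    have hKFR : K n * F n * R = F n := by
      rw [mul_assoc, hFr.eq, ← mul_assoc, hKr.eq, mul_assoc, hRKF n]
    have hFT' : Commute (F n) (star T) := by
      simpa [(hF n).star_eq] using hFT.star_star
    have hKT' : Commute (K n) (star T) := by
      simpa [(hK n).star_eq] using hKT.star_star
    have hN : IsStarNormal (T * K n) := by
      refine ⟨?_⟩
      rw [star_mul, (hK n).star_eq, hKT'.eq]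
      have h1 := hT.star_comm_self
      exact ((h1.mul_right hKT'.symm).mul_left (hKT.mul_right (Commute.refl _)))
    have hsemi : SemiconjBy (F n * B * F n) (star (T * K n)) (-(T * K n)) := by
      ext v
      have h1 : F n v = R (K n (F n v)) := congr($((hRKF n).symm) v)
      have h2 := hTadj (K n (F n v))
      rw [← h1] at h2
      have h3 := hTA _ _ (hanti _ _ h2)
      have h4 : F n * B * F n * star (T * K n) = F n * B * (star T * (K n * F n)) := by
        rw [star_mul, (hK n).star_eq, mul_assoc _ (F n), hKT'.eq, ← mul_assoc (F n), hFT'.eq,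
          mul_assoc (star T), hKF.eq]
      have h5 : -(T * K n) * (F n * B * F n) = -(K n * F n * (T * (B * F n))) := by
        rw [← hKT.eq, neg_mul, mul_assoc (K n), ← mul_assoc T, ← mul_assoc T, ← hFT.eq]
        simp only [mul_assoc]
      rw [h4, h5]
      change F n (B (star T (K n (F n v)))) = -(K n * F n) (T (B (F n v)))
      rw [h3, _root_.map_neg, _root_.map_neg, neg_neg]
      exact congr($hKFR.symm _)
    have hfug := (SemiconjBy.star_right hN.star hN.neg hsemi).eq
    rw [star_star, star_neg] at hfug
    have hFTK : ∀ {u u'}, (u, u') ∈ A.graph → F n (T (K n u)) = F n u' := by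
      intro u u' hu
      have h1 : F n * (T * K n) = K n * F n * T := by
        rw [← hKT.eq, ← mul_assoc, hKF.eq]
      have h3 : F n (T (K n u)) = (K n * F n) (T u) := congr($h1 u)
      rw [h3, hTA _ _ hu]
      exact congr($hKFR u')
    have h1 : F n (B (F n (T (K n x)))) = -star (T * K n) (F n (B (F n x))) := congr($hfug x)
    rw [hFTK hxy] at h1
    rw [← hFTK ha, hstar (hF n), inner_neg_right, hstar (hF n), h1, inner_neg_right, neg_neg,
      ContinuousLinearMap.star_eq_adjoint, ContinuousLinearMap.adjoint_inner_right]
    rfl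
  have hl : Filter.Tendsto (fun n => ⟪F n a', B (F n x)⟫_ℂ) Filter.atTop (nhds ⟪a', B x⟫_ℂ) :=
    (hlim a').inner ((B.continuous.tendsto _).comp (hlim x))
  have hr : Filter.Tendsto (fun n => ⟪F n a, -B (F n y)⟫_ℂ) Filter.atTop (nhds ⟪a, -B y⟫_ℂ) :=
    (hlim a).inner ((B.continuous.tendsto _).comp (hlim y)).neg
  simp only [key] at hl
  exact tendsto_nhds_unique hl hr

end LinearPMap.IsNormalOp

theorem statement10 (A : H →ₗ.[ℂ] H) (hA : A.IsNormalOp)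
    (B : H →L[ℂ] H) (hB : ∀ x y : H, ⟪B x, y⟫_ℂ = ⟪x, B y⟫_ℂ)
    (hanti : ∀ x : A†.domain, ∃ h : B (x : H) ∈ A.domain,
      B (A† x) = - A ⟨B (x : H), h⟩) :
    (A + (B : H →ₗ[ℂ] H).toPMap ⊤)†.pmul (A + (B : H →ₗ[ℂ] H).toPMap ⊤) =
      (A + (B : H →ₗ[ℂ] H).toPMap ⊤).pmul (A + (B : H →ₗ[ℂ] H).toPMap ⊤)† := by
  have hBA : ∀ x y, (x, y) ∈ A†.graph → (B x, -B y) ∈ A.graph := by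
    intro x y hxy
    obtain ⟨u, hu, huy⟩ := (mem_graph_iff _).1 hxy
    simp only at hu huy
    obtain ⟨h, hBu⟩ := hanti u
    rw [← hu, ← huy, hBu, neg_neg]
    exact A.mem_graph ⟨_, h⟩
  refine eq_of_eq_graph ?_
  ext ⟨x, z⟩
  simp only [mem_graph_pmul_iff, mem_graph_add_toPMap_iff,
    mem_graph_adjoint_add_toPMap_iff hA.dense hB]
  constructor
  · rintro ⟨y, hxy, hyz⟩
    have h1 := A†.graph.sub_mem hyz (hA.apply_mem_graph_adjoint hBA hxy)
    obtain ⟨w, hxw, hw⟩ := (hA.exists_adjoint_self_iff _ _).1 ⟨_, hxy, h1⟩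
    refine ⟨w + B x, by simpa using hxw, ?_⟩
    convert A.graph.add_mem hw (hBA _ _ hxw) using 1
    refine Prod.ext rfl ?_
    change z - B (w + B x) = z - B y - -B (y - B x) + -B w
    rw [_root_.map_add, _root_.map_sub]
    abel
  · rintro ⟨y, hxy, hyz⟩
    have h1 := A.graph.sub_mem hyz (hBA _ _ hxy)
    obtain ⟨w, hxw, hw⟩ := (hA.exists_adjoint_self_iff _ _).2 ⟨_, hxy, h1⟩
    refine ⟨w + B x, by simpa using hxw, ?_⟩
    convert A†.graph.add_mem hw (hA.apply_mem_graph_adjoint hBA hxw) using 1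
    refine Prod.ext rfl ?_
    change z - B (w + B x) = z - B y - -B (y - B x) + -B w
    rw [_root_.map_add, _root_.map_sub]
    abel
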